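/- Let (X,d) be a proper length metric space, K : X → [0,∞) continuous with Σ := {K = 0} finite, and suppose K(x) ≥ k(d(x,Σ)) for some continuous k : [0,∞) → [0,∞) with ∫_0^∞ k(t) dt = +∞. Then every d-locally Lipschitz curve γ : I → X is also locally Lipschitz with respect to d_K, and its metric derivative in (X, d_K), denoted |γ̇|_K, satisfies |γ̇|_K(t) = K(γ(t)) · |γ̇|(t) for almost every t ∈ I, where |γ̇| is the metric derivative with respect to d. -/

import Mathlib

open Filter Topology MeasureTheory Set
open scoped ENNReal NNReal Classical

section Defs

variable {X : Type*} [MetricSpace X]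

/-- The metric derivative of the curve `γ` within the set `I` at the point `t` exists and has
value `L`, i.e. `lim_{s → t, s ∈ I} dist (γ s) (γ t) / |s - t| = L`. -/
def HasMetricDerivWithinAt (γ : ℝ → X) (I : Set ℝ) (t : ℝ) (L : ℝ) : Prop :=
  Tendsto (fun s => dist (γ s) (γ t) / |s - t|) (𝓝[I \ {t}] t) (𝓝 L)

/-- The metric derivative `|γ̇|(t)` of `γ` within `I` at `t` (junk value `0` if the defining
limit does not exist). -/
noncomputable def metricDerivWithin (γ : ℝ → X) (I : Set ℝ) (t : ℝ) : ℝ :=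
  if h : ∃ L, HasMetricDerivWithinAt γ I t L then h.choose else 0

/-- `γ` is locally Lipschitz on the set `s ⊆ ℝ`. -/
def LocallyLipschitzOnSet (γ : ℝ → X) (s : Set ℝ) : Prop :=
  ∀ t ∈ s, ∃ ε > 0, ∃ C : NNReal, LipschitzOnWith C γ (s ∩ Metric.ball t ε)

/-- `γ` is a piecewise locally Lipschitz curve on the interval `I`: it is continuous on `I`
and locally Lipschitz outside finitely many points of `I` (equivalently, there are
`t_0 = inf I < t_1 < ⋯ < t_n = sup I` such that `γ` is locally Lipschitz on each
`I ∩ (t_i, t_(i+1))`). -/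
def PiecewiseLocLipOn (γ : ℝ → X) (I : Set ℝ) : Prop :=
  ContinuousOn γ I ∧ ∃ S : Finset ℝ, LocallyLipschitzOnSet γ (I \ ↑S)

/-- The `K`-weighted length `L_K(γ) = ∫_I K (γ t) * |γ̇| t dt` of a curve `γ` defined on `I`. -/
noncomputable def KLength (K : X → ℝ) (γ : ℝ → X) (I : Set ℝ) : ℝ≥0∞ :=
  ∫⁻ t in I, ENNReal.ofReal (K (γ t) * metricDerivWithin γ I t)

/-- The filter of approach to the left endpoint of the interval `I` (the endpoint may be
`-∞`, i.e. `I` may be unbounded below). -/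
noncomputable def leftEndFilter (I : Set ℝ) : Filter ℝ :=
  if BddBelow I then 𝓝[I] (sInf I) else Filter.atBot ⊓ Filter.principal I

/-- The filter of approach to the right endpoint of the interval `I`. -/
noncomputable def rightEndFilter (I : Set ℝ) : Filter ℝ :=
  if BddAbove I then 𝓝[I] (sSup I) else Filter.atTop ⊓ Filter.principal I

/-- `γ`, defined on the nonempty interval `I`, is a path from `x` to `y`: it is continuous on
`I` and converges to `x` (resp. `y`) at the left (resp. right) endpoint of `I` (where the
value at an infinite endpoint is understood as a limit). -/
def IsPathOn (γ : ℝ → X) (I : Set ℝ) (x y : X) : Prop :=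
  I.Nonempty ∧ I.OrdConnected ∧ ContinuousOn γ I ∧
    Tendsto γ (leftEndFilter I) (𝓝 x) ∧ Tendsto γ (rightEndFilter I) (𝓝 y)

/-- The weighted (pseudo-)distance `d_K(x,y)`: the infimum of `L_K` over piecewise locally
Lipschitz paths from `x` to `y`. -/
noncomputable def dK (K : X → ℝ) (x y : X) : ℝ≥0∞ :=
  ⨅ (γ : ℝ → X) (I : Set ℝ) (_ : PiecewiseLocLipOn γ I) (_ : IsPathOn γ I x y),
    KLength K γ I

/-- The intrinsic (geodesic) distance: the infimum of the length `L_d(γ) = eVariationOn γ I`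
over all paths from `x` to `y`. -/
noncomputable def geodDist (x y : X) : ℝ≥0∞ :=
  ⨅ (γ : ℝ → X) (I : Set ℝ) (_ : IsPathOn γ I x y), eVariationOn γ I

/-- A length space: the distance coincides with the intrinsic distance. -/
def IsLengthSpace (Y : Type*) [MetricSpace Y] : Prop :=
  ∀ x y : Y, geodDist x y = edist x y

/-- `K_r(x) := inf { K z : dist x z ≤ r }`. -/
noncomputable def Kinf (K : X → ℝ) (x : X) (r : ℝ) : ℝ :=
  sInf (K '' Metric.closedBall x r)

/-- `K^r(x) := sup { K z : dist x z ≤ r }`. -/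
noncomputable def Ksup (K : X → ℝ) (x : X) (r : ℝ) : ℝ :=
  sSup (K '' Metric.closedBall x r)

/-- The energy `E_W(γ) = ∫_I (½ |γ̇|(t)² + W (γ t)) dt`. -/
noncomputable def energyW (W : X → ℝ) (γ : ℝ → X) (I : Set ℝ) : ℝ≥0∞ :=
  ∫⁻ t in I, ENNReal.ofReal ((metricDerivWithin γ I t) ^ 2 / 2 + W (γ t))

end Defs

section MetricDerivative

variable {X : Type*} [MetricSpace X] {γ η : ℝ → X} {I : Set ℝ} {t L : ℝ}

lemma nhdsWithin_diff_singleton_of_mem_nhds (hI : I ∈ 𝓝 t) : 𝓝[I \ {t}] t = 𝓝[≠] t := by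
  rw [sdiff_eq, inter_comm]
  exact nhdsWithin_inter_of_mem' (mem_nhdsWithin_of_mem_nhds hI)

lemma HasMetricDerivWithinAt.mono_nhds (h : HasMetricDerivWithinAt γ univ t L) (hI : I ∈ 𝓝 t) :
    HasMetricDerivWithinAt γ I t L := by
  unfold HasMetricDerivWithinAt at *
  rwa [nhdsWithin_diff_singleton_of_mem_nhds hI,
    ← nhdsWithin_diff_singleton_of_mem_nhds (univ_mem : univ ∈ 𝓝 t)]

lemma HasMetricDerivWithinAt.congr_nhds (h : HasMetricDerivWithinAt γ I t L)
    (hη : η =ᶠ[𝓝 t] γ) : HasMetricDerivWithinAt η I t L := by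
  refine Tendsto.congr' ?_ h
  filter_upwards [nhdsWithin_le_nhds hη] with s hs
  rw [hs, hη.eq_of_nhds]

lemma HasMetricDerivWithinAt.metricDerivWithin_eq (h : HasMetricDerivWithinAt γ I t L)
    (hI : I ∈ 𝓝 t) : metricDerivWithin γ I t = L := by
  have hex : ∃ L, HasMetricDerivWithinAt γ I t L := ⟨L, h⟩
  rw [metricDerivWithin, dif_pos hex]
  have hne : (𝓝[I \ {t}] t).NeBot := by
    rw [nhdsWithin_diff_singleton_of_mem_nhds hI]
    infer_instance
  exact tendsto_nhds_unique hex.choose_spec h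

/-- A Lipschitz curve in a metric space is metrically differentiable almost everywhere. -/
theorem LipschitzWith.exists_measurable_metricDeriv {C : ℝ≥0} (hγ : LipschitzWith C γ) :
    ∃ m : ℝ → ℝ, Measurable m ∧ (∀ t, 0 ≤ m t) ∧ (∀ t, m t ≤ C) ∧
      ∀ᵐ t, HasMetricDerivWithinAt γ univ t (m t) := by
  set φ : ℚ → ℝ → ℝ := fun q s => dist (γ s) (γ q) with hφ
  have hφL : ∀ q, LipschitzWith C (φ q) := fun q => by
    have := (LipschitzWith.dist_left (γ q)).comp hγ
    rwa [one_mul] at this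
  have hbd : ∀ q t, |deriv (φ q) t| ≤ C := fun q t => norm_deriv_le_of_lipschitz (hφL q)
  have hba : ∀ t, BddAbove (range fun q => |deriv (φ q) t|) := fun t =>
    ⟨C, by rintro _ ⟨q, rfl⟩; exact hbd q t⟩
  set m : ℝ → ℝ := fun t => ⨆ q, |deriv (φ q) t| with hm
  have hmm : Measurable m := Measurable.iSup fun q => (measurable_deriv (φ q)).abs
  have hm0 : ∀ t, 0 ≤ m t := fun t => (abs_nonneg _).trans (le_ciSup (hba t) 0)
  have hmC : ∀ t, m t ≤ C := fun t => ciSup_le fun q => hbd q t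
  have hli : LocallyIntegrable m := by
    refine (locallyIntegrable_const (C : ℝ)).mono hmm.aestronglyMeasurable (ae_of_all _ fun t => ?_)
    simpa [abs_of_nonneg (hm0 t)] using hmC t
  have hii : ∀ a b, IntervalIntegrable m volume a b := fun a b =>
    (hli.integrableOn_isCompact isCompact_uIcc).intervalIntegrable
  have hbound : ∀ a b, a ≤ b → dist (γ a) (γ b) ≤ ∫ u in a..b, m u := by
    intro a b hab
    have hq : ∀ q : ℚ, φ q a - φ q b ≤ ∫ u in a..b, m u := by
      intro q
      have hac := ((hφL q).lipschitzOnWith (s := uIcc a b)).absolutelyContinuousOnInterval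
      have h1 := hac.integral_deriv_eq_sub
      calc φ q a - φ q b = ∫ u in a..b, - deriv (φ q) u := by
            rw [intervalIntegral.integral_neg, h1]; ring
        _ ≤ ∫ u in a..b, m u := by
            refine intervalIntegral.integral_mono_on hab hac.intervalIntegrable_deriv.neg
              (hii a b) fun u _ => ?_
            exact (neg_le_abs _).trans (le_ciSup (hba u) q)
    have hc : Continuous fun u => dist (γ a) (γ u) - dist (γ b) (γ u) := by
      have := hγ.continuous
      fun_prop
    have hall : ∀ u : ℝ, dist (γ a) (γ u) - dist (γ b) (γ u) ≤ ∫ u in a..b, m u := by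
      have hcl := isClosed_le hc (continuous_const (y := ∫ u in a..b, m u))
      intro u
      exact hcl.closure_subset_iff.2 (by rintro _ ⟨q, rfl⟩; exact hq q)
        (Rat.denseRange_cast (𝕜 := ℝ) u)
    simpa using hall b
  refine ⟨m, hmm, hm0, hmC, ?_⟩
  have hdiff : ∀ᵐ t, ∀ q, DifferentiableAt ℝ (φ q) t :=
    ae_all_iff.2 fun q => (hφL q).ae_differentiableAt_real
  filter_upwards [hdiff, LocallyIntegrable.ae_hasDerivAt_integral hli] with t ht hG
  rw [HasMetricDerivWithinAt, nhdsWithin_diff_singleton_of_mem_nhds univ_mem]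
  refine tendsto_order.2 ⟨fun a ha => ?_, fun a ha => ?_⟩
  · obtain ⟨q, hq⟩ := exists_lt_of_lt_ciSup ha
    have h1 := ((ht q).hasDerivAt.tendsto_slope).abs
    filter_upwards [h1.eventually (lt_mem_nhds hq), self_mem_nhdsWithin] with s hs hst
    refine hs.trans_le ?_
    rw [slope_def_field, abs_div]
    gcongr
    exact abs_dist_sub_le _ _ _
  · have h1 := (hG t).tendsto_slope
    filter_upwards [h1.eventually (gt_mem_nhds ha), self_mem_nhdsWithin] with s hs hst
    refine lt_of_le_of_lt ?_ hs
    rw [slope_def_field, intervalIntegral.integral_same, sub_zero]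
    rcases lt_or_gt_of_ne (show s ≠ t from hst) with h | h
    · rw [abs_of_neg (sub_neg.2 h), intervalIntegral.integral_symm, neg_div, ← div_neg]
      have : 0 < -(s - t) := by linarith
      gcongr
      exact hbound _ _ h.le
    · have h' : 0 < s - t := sub_pos.2 h
      rw [abs_of_pos h', dist_comm]
      gcongr
      exact hbound _ _ h.le

end MetricDerivative

section UpperBound

variable {X : Type*} [MetricSpace X] {γ : ℝ → X} {K : X → ℝ} {m : ℝ → ℝ} {C : ℝ≥0} {a b : ℝ}

lemma LipschitzOnWith.exists_lipschitzWith_eqOn_Icc (hab : a ≤ b)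
    (hγ : LipschitzOnWith C γ (Icc a b)) :
    ∃ η : ℝ → X, LipschitzWith C η ∧ EqOn η γ (Icc a b) ∧ ∀ s, η s ∈ γ '' Icc a b := by
  refine ⟨IccExtend hab ((Icc a b).domRestrict γ), ?_, fun s hs => ?_, fun s => ?_⟩
  · have := (lipschitzOnWith_iff_restrict.1 hγ).comp (LipschitzWith.projIcc hab)
    rwa [mul_one] at this
  · rw [IccExtend_of_mem hab _ hs, domRestrict_apply]
  · exact ⟨projIcc a b hab s, (projIcc a b hab s).2, rfl⟩

lemma dK_le_lintegral (hγ : LipschitzWith C γ)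
    (hm : ∀ᵐ t, HasMetricDerivWithinAt γ univ t (m t)) (hab : a ≤ b) :
    dK K (γ a) (γ b) ≤ ∫⁻ u in Icc a b, ENNReal.ofReal (K (γ u) * m u) := by
  have hlip : PiecewiseLocLipOn γ (Icc a b) :=
    ⟨hγ.continuous.continuousOn, ∅, fun t _ => ⟨1, one_pos, C, hγ.lipschitzOnWith⟩⟩
  have hpath : IsPathOn γ (Icc a b) (γ a) (γ b) := by
    refine ⟨nonempty_Icc.2 hab, ordConnected_Icc, hγ.continuous.continuousOn, ?_, ?_⟩
    · rw [leftEndFilter, if_pos bddBelow_Icc, csInf_Icc hab]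
      exact hγ.continuous.continuousAt.mono_left nhdsWithin_le_nhds
    · rw [rightEndFilter, if_pos bddAbove_Icc, csSup_Icc hab]
      exact hγ.continuous.continuousAt.mono_left nhdsWithin_le_nhds
  refine (iInf₂_le_of_le γ (Icc a b) (iInf₂_le_of_le hlip hpath le_rfl)).trans_eq ?_
  rw [KLength, ← setLIntegral_congr Ioo_ae_eq_Icc, ← setLIntegral_congr Ioo_ae_eq_Icc]
  refine setLIntegral_congr_fun_ae measurableSet_Ioo ?_
  filter_upwards [hm] with u hu hmem
  have hI := Icc_mem_nhds hmem.1 hmem.2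
  rw [(hu.mono_nhds hI).metricDerivWithin_eq hI]

lemma dK_le_lintegral_reverse (hγ : LipschitzWith C γ)
    (hm : ∀ᵐ t, HasMetricDerivWithinAt γ univ t (m t)) (hab : a ≤ b) :
    dK K (γ b) (γ a) ≤ ∫⁻ u in Icc a b, ENNReal.ofReal (K (γ u) * m u) := by
  have hη : LipschitzWith C fun u => γ (-u) := by
    have := hγ.comp (LipschitzWith.id.neg : LipschitzWith 1 fun u : ℝ => -u)
    rwa [mul_one] at this
  have hm' : ∀ᵐ t, HasMetricDerivWithinAt (fun u => γ (-u)) univ t (m (-t)) := by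
    have h := (Measure.measurePreserving_neg (volume : Measure ℝ)).quasiMeasurePreserving.ae hm
    filter_upwards [h] with t ht
    rw [HasMetricDerivWithinAt, nhdsWithin_diff_singleton_of_mem_nhds univ_mem] at *
    have hneg : Tendsto (fun s : ℝ => -s) (𝓝[≠] t) (𝓝[≠] (-t)) :=
      (continuous_neg.continuousWithinAt).tendsto_nhdsWithin fun s hs => by simpa using hs
    refine (ht.comp hneg).congr fun s => ?_
    simp only [Function.comp]
    rw [← neg_add', abs_neg, ← sub_eq_add_neg]
  have h := dK_le_lintegral (K := K) hη hm' (neg_le_neg hab)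
  simp only [neg_neg] at h
  refine h.trans_eq ?_
  have hpre : (fun u : ℝ => -u) ⁻¹' Icc a b = Icc (-b) (-a) := by simp
  rw [← hpre]
  exact (Measure.measurePreserving_neg (volume : Measure ℝ)).setLIntegral_comp_preimage_emb
    (MeasurableEquiv.neg ℝ).measurableEmbedding (fun u => ENNReal.ofReal (K (γ u) * m u)) _

lemma dK_le_lintegral_uIcc (hγ : LipschitzWith C γ)
    (hm : ∀ᵐ t, HasMetricDerivWithinAt γ univ t (m t)) (a b : ℝ) :
    dK K (γ a) (γ b) ≤ ∫⁻ u in uIcc a b, ENNReal.ofReal (K (γ u) * m u) := by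
  rcases le_total a b with h | h
  · rw [uIcc_of_le h]
    exact dK_le_lintegral hγ hm h
  · rw [uIcc_of_ge h]
    exact dK_le_lintegral_reverse hγ hm h

lemma LipschitzOnWith.dK_le {M : ℝ} (hγ : LipschitzOnWith C γ (uIcc a b)) (hM0 : 0 ≤ M)
    (hM : ∀ u ∈ uIcc a b, K (γ u) ≤ M) :
    dK K (γ a) (γ b) ≤ ENNReal.ofReal (M * C * |a - b|) := by
  obtain ⟨η, hη, heq, hmem⟩ := hγ.exists_lipschitzWith_eqOn_Icc inf_le_sup
  obtain ⟨m, -, hm0, hmC, hm⟩ := hη.exists_measurable_metricDeriv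
  rw [← heq left_mem_uIcc, ← heq right_mem_uIcc]
  refine (dK_le_lintegral_uIcc hη hm a b).trans ?_
  calc ∫⁻ u in uIcc a b, ENNReal.ofReal (K (η u) * m u)
      ≤ ∫⁻ u in uIcc a b, ENNReal.ofReal (M * C) := by
        refine lintegral_mono fun u => ENNReal.ofReal_le_ofReal ?_
        obtain ⟨v, hv, hvu⟩ := hmem u
        exact mul_le_mul (hvu ▸ hM v hv) (hmC u) (hm0 u) hM0
    _ = ENNReal.ofReal (M * C * |a - b|) := by
        rw [setLIntegral_const, Real.volume_interval, abs_sub_comm,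
          ← ENNReal.ofReal_mul (by positivity)]

lemma LipschitzWith.ae_eventually_dK_le (hKc : Continuous K) (hK0 : ∀ x, 0 ≤ K x)
    (hγ : LipschitzWith C γ) (hmm : Measurable m) (hm0 : ∀ t, 0 ≤ m t) (hmC : ∀ t, m t ≤ C)
    (hm : ∀ᵐ t, HasMetricDerivWithinAt γ univ t (m t)) :
    ∀ᵐ t, ∀ c > K (γ t) * m t, ∀ᶠ s in 𝓝[≠] t,
      dK K (γ t) (γ s) ≤ ENNReal.ofReal (c * |s - t|) := by
  have hKγ : Continuous fun u => K (γ u) := hKc.comp hγ.continuous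
  have hg0 : ∀ u, 0 ≤ K (γ u) * m u := fun u => mul_nonneg (hK0 _) (hm0 u)
  have hli : LocallyIntegrable fun u => K (γ u) * m u := by
    refine (hKγ.mul (continuous_const (y := (C : ℝ)))).locallyIntegrable.mono
      (hKγ.measurable.mul hmm).aestronglyMeasurable (ae_of_all _ fun u => ?_)
    rw [Real.norm_of_nonneg (hg0 u)]
    exact (mul_le_mul_of_nonneg_left (hmC u) (hK0 _)).trans (le_abs_self _)
  filter_upwards [LocallyIntegrable.ae_hasDerivAt_integral hli] with t hG c hc
  filter_upwards [(hG t).tendsto_slope.eventually (gt_mem_nhds hc), self_mem_nhdsWithin]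
    with s hs hst
  refine (dK_le_lintegral_uIcc hγ hm t s).trans ?_
  rw [← ofReal_integral_eq_lintegral_ofReal (hli.integrableOn_isCompact isCompact_uIcc)
    (ae_of_all _ hg0)]
  refine ENNReal.ofReal_le_ofReal ?_
  rw [slope_def_field, intervalIntegral.integral_same, sub_zero] at hs
  rw [← div_le_iff₀ (abs_pos.2 (sub_ne_zero.2 hst))]
  refine le_trans (le_of_eq ?_) hs.le
  rcases lt_or_gt_of_ne (show s ≠ t from hst) with h | h
  · rw [abs_of_neg (sub_neg.2 h), intervalIntegral.integral_symm, neg_div, ← div_neg,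
      intervalIntegral.integral_of_le h.le, uIcc_of_ge h.le, integral_Icc_eq_integral_Ioc]
  · rw [abs_of_pos (sub_pos.2 h), intervalIntegral.integral_of_le h.le, uIcc_of_le h.le,
      integral_Icc_eq_integral_Ioc]

end UpperBound

section LowerBound

lemma Set.OrdConnected.finite_diff_interior {I : Set ℝ} (hI : I.OrdConnected) :
    (I \ interior I).Finite := by
  have hleast : {t | IsLeast I t}.Subsingleton := fun s hs t ht => hs.unique ht
  have hgreatest : {t | IsGreatest I t}.Subsingleton := fun s hs t ht => hs.unique ht
  refine (hleast.finite.union hgreatest.finite).subset fun t ht => ?_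
  by_contra hcon
  simp only [mem_union, mem_ofPred_eq, IsLeast, IsGreatest, lowerBounds, upperBounds, not_or,
    not_and, not_forall, not_le] at hcon
  obtain ⟨a, ha, hat⟩ := hcon.1 ht.1
  obtain ⟨b, hb, htb⟩ := hcon.2 ht.1
  exact ht.2 (mem_interior_iff_mem_nhds.2
    (mem_of_superset (Icc_mem_nhds hat htb) (hI.out ha hb)))

lemma LipschitzOnWith.volume_image_eq_zero {C : ℝ≥0} {h : ℝ → ℝ} {s : Set ℝ}
    (hh : LipschitzOnWith C h s) (hs : volume s = 0) : volume (h '' s) = 0 := by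
  have := hh.hausdorffMeasure_image_le (d := 1) zero_le_one
  rwa [hausdorffMeasure_real, hs, mul_zero, nonpos_iff_eq_zero] at this

lemma LocallyLipschitzOnSet.exists_ball {X : Type*} [MetricSpace X] {γ : ℝ → X} {s : Set ℝ}
    {t : ℝ} (hγ : LocallyLipschitzOnSet γ s) (hs : s ∈ 𝓝 t) :
    ∃ ε > 0, Metric.ball t ε ⊆ s ∧ ∃ C : ℝ≥0, LipschitzOnWith C γ (Metric.ball t ε) := by
  obtain ⟨ε, hε, C, hC⟩ := hγ t (mem_of_mem_nhds hs)
  obtain ⟨δ, hδ, hsub⟩ := Metric.mem_nhds_iff.1 hs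
  have h1 : Metric.ball t (min ε δ) ⊆ s :=
    (Metric.ball_subset_ball (min_le_right _ _)).trans hsub
  exact ⟨min ε δ, lt_min hε hδ, h1, C,
    hC.mono (subset_inter h1 (Metric.ball_subset_ball (min_le_left _ _)))⟩

lemma volume_image_le_lintegral_abs_deriv {h : ℝ → ℝ} {I : Set ℝ} (hI : I.OrdConnected)
    {S : Set ℝ} (hS : S.Finite) (hh : LocallyLipschitzOnSet h (I \ S)) :
    volume (h '' I) ≤ ∫⁻ t in I, ENNReal.ofReal |deriv h t| := by
  set U := interior I \ S with hU
  have hUo : IsOpen U := isOpen_interior.sdiff hS.isClosed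
  have hUI : U ⊆ I \ S := sdiff_subset_sdiff_left interior_subset
  set D := U ∩ {t | DifferentiableAt ℝ h t} with hD
  have hN : volume (h '' (U \ D)) = 0 := by
    change OuterMeasure.comap h volume.toOuterMeasure (U \ D) = 0
    refine measure_null_of_locally_null _ fun t ht => ?_
    obtain ⟨ε, hε, hb, C, hC⟩ := hh.exists_ball (mem_of_superset (hUo.mem_nhds ht.1) hUI)
    refine ⟨(U \ D) ∩ Metric.ball t ε,
      inter_mem self_mem_nhdsWithin (mem_nhdsWithin_of_mem_nhds (Metric.ball_mem_nhds t hε)), ?_⟩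
    rw [OuterMeasure.comap_apply]
    change volume _ = 0
    refine (hC.mono inter_subset_right).volume_image_eq_zero ?_
    refine measure_mono_null ?_ (ae_iff.1 hC.ae_differentiableWithinAt_of_mem_real)
    intro u hu hdiff
    exact hu.1.2 ⟨hu.1.1, (hdiff hu.2).differentiableAt (Metric.isOpen_ball.mem_nhds hu.2)⟩
  have hF : volume (h '' (I \ U)) = 0 := by
    have hfin : (I \ U).Finite := by
      refine (hI.finite_diff_interior.union hS).subset fun t ht => ?_
      by_cases hts : t ∈ S
      · exact Or.inr hts
      · exact Or.inl ⟨ht.1, fun hti => ht.2 ⟨hti, hts⟩⟩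
    exact (hfin.image h).measure_zero _
  have hDm : MeasurableSet D := hUo.measurableSet.inter (measurableSet_of_differentiableAt ℝ h)
  have himg : volume (h '' D) ≤ ∫⁻ t in D, ENNReal.ofReal |deriv h t| := by
    simpa only [ContinuousLinearMap.det_toSpanSingleton] using
      addHaar_image_le_lintegral_abs_det_fderiv volume hDm
        fun t ht => (ht.2.hasDerivAt.hasDerivWithinAt (s := D)).hasFDerivWithinAt
  have hcover : h '' I ⊆ h '' D ∪ (h '' (U \ D) ∪ h '' (I \ U)) := by
    rw [← image_union, ← image_union]
    refine image_mono fun t ht => ?_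
    by_cases hU' : t ∈ U <;> by_cases hD' : t ∈ D <;> simp [hU', hD', ht]
  calc volume (h '' I) ≤ volume (h '' D) + (volume (h '' (U \ D)) + volume (h '' (I \ U))) :=
        (measure_mono hcover).trans ((measure_union_le _ _).trans
          (by gcongr; exact measure_union_le _ _))
    _ = volume (h '' D) := by rw [hN, hF, add_zero, add_zero]
    _ ≤ ∫⁻ t in D, ENNReal.ofReal |deriv h t| := himg
    _ ≤ ∫⁻ t in I, ENNReal.ofReal |deriv h t| :=
        lintegral_mono_set fun t ht => (hUI ht.1).1

variable {X : Type*} [MetricSpace X]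

/-- To prove an almost everywhere local property of a locally Lipschitz curve, it suffices to
prove it for globally Lipschitz curves. -/
lemma LocallyLipschitzOnSet.ae_of_lipschitzWith {γ : ℝ → X} {s : Set ℝ}
    (hγ : LocallyLipschitzOnSet γ s) {P : ℝ → Prop}
    (hP : ∀ (C : ℝ≥0) (η : ℝ → X), LipschitzWith C η → ∀ᵐ u, γ =ᶠ[𝓝 u] η → u ∈ interior s → P u) :
    ∀ᵐ t, t ∈ interior s → P t := by
  rw [ae_iff]
  refine measure_null_of_locally_null _ fun t ht => ?_
  simp only [mem_ofPred_eq, Classical.not_imp] at ht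
  obtain ⟨ε, hε, hb, C, hC⟩ := hγ.exists_ball (mem_interior_iff_mem_nhds.1 ht.1)
  have hsub : Icc (t - ε / 2) (t + ε / 2) ⊆ Metric.ball t ε := by
    rw [← Real.closedBall_eq_Icc]
    exact Metric.closedBall_subset_ball (by linarith)
  obtain ⟨η, hη, heq, -⟩ := (hC.mono hsub).exists_lipschitzWith_eqOn_Icc (by linarith)
  have hnull := ae_iff.1 (hP C η hη)
  refine ⟨_, inter_mem self_mem_nhdsWithin (mem_nhdsWithin_of_mem_nhds
    (Ioo_mem_nhds (show t - ε / 2 < t by linarith) (show t < t + ε / 2 by linarith))),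
    measure_mono_null ?_ hnull⟩
  intro u hu hcon
  refine hu.1 (hcon ?_)
  filter_upwards [Icc_mem_nhds hu.2.1 hu.2.2] with v hv using (heq hv).symm

lemma LocallyLipschitzOnSet.ae_exists_hasMetricDerivWithinAt {γ : ℝ → X} {s : Set ℝ}
    (hγ : LocallyLipschitzOnSet γ s) :
    ∀ᵐ t, t ∈ interior s → ∃ L, HasMetricDerivWithinAt γ univ t L := by
  refine hγ.ae_of_lipschitzWith fun C η hη => ?_
  obtain ⟨m, -, -, -, hm⟩ := hη.exists_measurable_metricDeriv
  filter_upwards [hm] with t ht hev _ using ⟨m t, ht.congr_nhds hev⟩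

lemma leftEndFilter_neBot {I : Set ℝ} (hne : I.Nonempty) : (leftEndFilter I).NeBot := by
  rw [leftEndFilter]
  split_ifs with h
  · exact mem_closure_iff_nhdsWithin_neBot.1 (csInf_mem_closure hne h)
  · rw [inf_principal_neBot_iff]
    intro U hU
    obtain ⟨a, ha⟩ := mem_atBot_sets.1 hU
    obtain ⟨b, hb, hba⟩ := not_bddBelow_iff.1 h a
    exact ⟨b, ha b hba.le, hb⟩

lemma rightEndFilter_neBot {I : Set ℝ} (hne : I.Nonempty) : (rightEndFilter I).NeBot := by
  rw [rightEndFilter]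
  split_ifs with h
  · exact mem_closure_iff_nhdsWithin_neBot.1 (csSup_mem_closure hne h)
  · rw [inf_principal_neBot_iff]
    intro U hU
    obtain ⟨a, ha⟩ := mem_atTop_sets.1 hU
    obtain ⟨b, hb, hba⟩ := not_bddAbove_iff.1 h a
    exact ⟨b, ha b hba.le, hb⟩

lemma mem_leftEndFilter (I : Set ℝ) : I ∈ leftEndFilter I := by
  rw [leftEndFilter]
  split_ifs
  · exact self_mem_nhdsWithin
  · exact mem_inf_of_right (mem_principal_self I)

lemma mem_rightEndFilter (I : Set ℝ) : I ∈ rightEndFilter I := by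
  rw [rightEndFilter]
  split_ifs
  · exact self_mem_nhdsWithin
  · exact mem_inf_of_right (mem_principal_self I)

lemma IsPathOn.Ioo_subset_image {γ : ℝ → X} {I : Set ℝ} {x y : X} (hγ : IsPathOn γ I x y)
    {f : X → ℝ} (hf : Continuous f) : Ioo (f x) (f y) ⊆ (fun t => f (γ t)) '' I := by
  obtain ⟨hne, hoc, hc, hl, hr⟩ := hγ
  intro v hv
  have := leftEndFilter_neBot hne
  have := rightEndFilter_neBot hne
  obtain ⟨a, ha, haI⟩ := ((((hf.tendsto x).comp hl).eventually (gt_mem_nhds hv.1)).and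
    (mem_leftEndFilter I)).exists
  obtain ⟨b, hb, hbI⟩ := ((((hf.tendsto y).comp hr).eventually (lt_mem_nhds hv.2)).and
    (mem_rightEndFilter I)).exists
  exact hoc.isPreconnected.intermediate_value haI hbI (hf.comp_continuousOn hc)
    ⟨le_of_lt ha, le_of_lt hb⟩

/-- The derivative of a `1`-Lipschitz observable along a curve is at most the metric speed. -/
lemma HasMetricDerivWithinAt.abs_deriv_comp_le {γ : ℝ → X} {t L : ℝ} {f : X → ℝ}
    (hL : HasMetricDerivWithinAt γ univ t L) (hf : LipschitzWith 1 f) :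
    |deriv (fun s => f (γ s)) t| ≤ L := by
  rw [HasMetricDerivWithinAt, nhdsWithin_diff_singleton_of_mem_nhds univ_mem] at hL
  by_cases hd : DifferentiableAt ℝ (fun s => f (γ s)) t
  · refine le_of_tendsto_of_tendsto' hd.hasDerivAt.tendsto_slope.abs hL fun s => ?_
    rw [slope_def_field, abs_div]
    gcongr
    simpa [Real.dist_eq] using hf.dist_le_mul (γ s) (γ t)
  · rw [deriv_zero_of_not_differentiableAt hd, abs_zero]
    exact ge_of_tendsto' hL fun s => by positivity

/-- If `κ ≤ K` on the ball of radius `r` around `x`, then leaving that ball costs at least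
`κ * r`, and reaching a point `y` inside it costs at least `κ * dist x y`. -/
lemma ofReal_mul_min_dist_le_dK {K : X → ℝ} (hK0 : ∀ x, 0 ≤ K x) {x y : X} {κ r : ℝ}
    (hκ0 : 0 ≤ κ) (hr : 0 < r) (hκ : ∀ z, dist z x < r → κ ≤ K z) :
    ENNReal.ofReal (κ * min (dist y x) r) ≤ dK K x y := by
  refine le_iInf₂ fun η I => le_iInf₂ fun hη hpath => ?_
  obtain ⟨-, S, hS⟩ := hη
  set f : X → ℝ := fun z => min (dist z x) r with hf
  have hfL : LipschitzWith 1 f := (LipschitzWith.dist_left x).min_const r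
  have hSI : interior (I \ S) = interior I \ S := by
    rw [sdiff_eq, interior_inter, (S.finite_toSet.isClosed.isOpen_compl).interior_eq, ← sdiff_eq]
  have hcomp : LocallyLipschitzOnSet (fun t => f (η t)) (I \ S) := fun t ht => by
    obtain ⟨ε, hε, C, hC⟩ := hS t ht
    exact ⟨ε, hε, 1 * C, hfL.comp_lipschitzOnWith hC⟩
  have hae : ∀ᵐ t ∂(volume.restrict I), t ∈ interior I \ (S : Set ℝ) := by
    have hfin : (I \ interior I ∪ S).Finite :=
      hpath.2.1.finite_diff_interior.union S.finite_toSet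
    rw [ae_restrict_iff' hpath.2.1.measurableSet]
    filter_upwards [compl_mem_ae_iff.2 (hfin.measure_zero volume)] with t ht htI
    by_contra hcon
    refine ht ?_
    by_cases hts : t ∈ (S : Set ℝ)
    · exact Or.inr hts
    · exact Or.inl ⟨htI, fun hti => hcon ⟨hti, hts⟩⟩
  calc ENNReal.ofReal (κ * min (dist y x) r)
      = ENNReal.ofReal κ * volume (Ioo (f x) (f y)) := by
        rw [Real.volume_Ioo, ← ENNReal.ofReal_mul hκ0]
        simp [hf, hr.le]
    _ ≤ ENNReal.ofReal κ * ∫⁻ t in I, ENNReal.ofReal |deriv (fun t => f (η t)) t| := by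
        gcongr
        exact (measure_mono (hpath.Ioo_subset_image hfL.continuous)).trans
          (volume_image_le_lintegral_abs_deriv hpath.2.1 S.finite_toSet hcomp)
    _ = ∫⁻ t in I, ENNReal.ofReal κ * ENNReal.ofReal |deriv (fun t => f (η t)) t| := by
        rw [lintegral_const_mul _ (measurable_deriv _).abs.ennreal_ofReal]
    _ ≤ KLength K η I := by
        refine lintegral_mono_ae ?_
        filter_upwards [hae, ae_restrict_of_ae hS.ae_exists_hasMetricDerivWithinAt] with t htU hex
        rw [hSI] at hex
        obtain ⟨L, hL⟩ := hex htU
        have hI : I ∈ 𝓝 t := mem_interior_iff_mem_nhds.1 htU.1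
        rw [(hL.mono_nhds hI).metricDerivWithin_eq hI, ← ENNReal.ofReal_mul hκ0]
        refine ENNReal.ofReal_le_ofReal ?_
        have hle := hL.abs_deriv_comp_le hfL
        rcases lt_or_ge (dist (η t) x) r with h | h
        · exact mul_le_mul (hκ _ h) hle (abs_nonneg _) (hK0 _)
        · have hmax : IsLocalMax (fun t => f (η t)) t := by
            refine Eventually.of_forall fun s => ?_
            simp only [hf, min_eq_right h]
            exact min_le_right _ _
          rw [hmax.deriv_eq_zero, abs_zero, mul_zero]
          exact mul_nonneg (hK0 _) ((abs_nonneg _).trans hle)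

end LowerBound

section MainTheorem

variable {X : Type*} [MetricSpace X] {K : X → ℝ} {γ : ℝ → X}

lemma tendsto_dK_div_of_eventually_le (hKc : Continuous K) (hK0 : ∀ x, 0 ≤ K x) {t L : ℝ}
    (hcont : ContinuousAt γ t) (hL : HasMetricDerivWithinAt γ univ t L)
    (hup : ∀ c > K (γ t) * L, ∀ᶠ s in 𝓝[≠] t,
      dK K (γ t) (γ s) ≤ ENNReal.ofReal (c * |s - t|)) :
    Tendsto (fun s => (dK K (γ t) (γ s)).toReal / |s - t|) (𝓝[≠] t) (𝓝 (K (γ t) * L)) := by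
  rw [HasMetricDerivWithinAt, nhdsWithin_diff_singleton_of_mem_nhds univ_mem] at hL
  have hL0 : 0 ≤ L := ge_of_tendsto' hL fun s => by positivity
  have hKL : 0 ≤ K (γ t) * L := mul_nonneg (hK0 _) hL0
  refine tendsto_order.2 ⟨fun a ha => ?_, fun a ha => ?_⟩
  · rcases lt_or_ge a 0 with ha0 | ha0
    · exact Eventually.of_forall fun s => ha0.trans_le (by positivity)
    have hLpos : 0 < L := by
      refine hL0.lt_of_ne fun h => ?_
      rw [← h, mul_zero] at ha
      exact ha.not_ge ha0
    obtain ⟨κ, hκ1, hκ2⟩ := exists_between ((div_lt_iff₀ hLpos).2 ha)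
    have hκ0 : 0 ≤ κ := (div_nonneg ha0 hL0).trans hκ1.le
    obtain ⟨r, hr, hball⟩ := Metric.mem_nhds_iff.1
      (hKc.continuousAt.eventually (lt_mem_nhds hκ2))
    have hlim := (hL.const_mul κ).eventually (lt_mem_nhds ((div_lt_iff₀ hLpos).1 hκ1))
    filter_upwards [hlim, hup _ (lt_add_one _), self_mem_nhdsWithin,
      nhdsWithin_le_nhds (hcont.eventually (Metric.ball_mem_nhds (γ t) hr))] with s hs hfin hst hsr
    refine hs.trans_le ?_
    rw [← mul_div_assoc]
    gcongr
    have h := ofReal_mul_min_dist_le_dK hK0 (y := γ s) hκ0 hr fun z hz => (hball hz).le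
    rw [min_eq_left (le_of_lt hsr)] at h
    exact (ENNReal.ofReal_le_iff_le_toReal (ne_top_of_le_ne_top ENNReal.ofReal_ne_top hfin)).1 h
  · obtain ⟨c, hc1, hc2⟩ := exists_between ha
    filter_upwards [hup c hc1, self_mem_nhdsWithin] with s hs hst
    refine lt_of_le_of_lt ?_ hc2
    rw [div_le_iff₀ (abs_pos.2 (sub_ne_zero.2 hst))]
    exact ENNReal.toReal_le_of_le_ofReal (mul_nonneg (hKL.trans hc1.le) (abs_nonneg _)) hs

lemma LipschitzWith.ae_tendsto_dK_div {C : ℝ≥0} (hKc : Continuous K) (hK0 : ∀ x, 0 ≤ K x)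
    (hγ : LipschitzWith C γ) :
    ∀ᵐ t, ∃ L, HasMetricDerivWithinAt γ univ t L ∧
      Tendsto (fun s => (dK K (γ t) (γ s)).toReal / |s - t|) (𝓝[≠] t) (𝓝 (K (γ t) * L)) := by
  obtain ⟨m, hmm, hm0, hmC, hm⟩ := hγ.exists_measurable_metricDeriv
  filter_upwards [hm, hγ.ae_eventually_dK_le hKc hK0 hmm hm0 hmC hm] with t ht hup
  exact ⟨m t, ht, tendsto_dK_div_of_eventually_le hKc hK0 hγ.continuous.continuousAt ht hup⟩

lemma LocallyLipschitzOnSet.ae_tendsto_dK_div {I : Set ℝ} (hKc : Continuous K)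
    (hK0 : ∀ x, 0 ≤ K x) (hγ : LocallyLipschitzOnSet γ I) :
    ∀ᵐ t, t ∈ interior I → Tendsto (fun s => (dK K (γ t) (γ s)).toReal / |s - t|) (𝓝[I \ {t}] t)
      (𝓝 (K (γ t) * metricDerivWithin γ I t)) := by
  refine hγ.ae_of_lipschitzWith fun C η hη => ?_
  filter_upwards [hη.ae_tendsto_dK_div hKc hK0] with u hu hev hmem
  obtain ⟨L, hL, hlim⟩ := hu
  have hI : I ∈ 𝓝 u := mem_interior_iff_mem_nhds.1 hmem
  rw [((hL.congr_nhds hev).mono_nhds hI).metricDerivWithin_eq hI,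
    nhdsWithin_diff_singleton_of_mem_nhds hI, hev.eq_of_nhds]
  refine hlim.congr' ?_
  filter_upwards [nhdsWithin_le_nhds hev] with s hs
  rw [hs]

lemma LocallyLipschitzOnSet.exists_dK_le {I : Set ℝ} (hKc : Continuous K) (hK0 : ∀ x, 0 ≤ K x)
    (hI : I.OrdConnected) (hγ : LocallyLipschitzOnSet γ I) {t : ℝ} (ht : t ∈ I) :
    ∃ ε > (0 : ℝ), ∃ C : NNReal,
      ∀ s ∈ I ∩ Metric.ball t ε, ∀ s' ∈ I ∩ Metric.ball t ε,
        dK K (γ s) (γ s') ≤ ENNReal.ofReal (C * |s - s'|) := by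
  obtain ⟨ε, hε, C, hC⟩ := hγ t ht
  have hcont : ContinuousWithinAt (fun s => K (γ s)) (I ∩ Metric.ball t ε) t :=
    hKc.continuousAt.comp_continuousWithinAt
      (hC.continuousOn t ⟨ht, Metric.mem_ball_self hε⟩)
  obtain ⟨δ, hδ, hsub⟩ := Metric.mem_nhdsWithin_iff.1
    (hcont.eventually (gt_mem_nhds (lt_add_one (K (γ t)))))
  refine ⟨min ε δ, lt_min hε hδ, ⟨K (γ t) + 1, by linarith [hK0 (γ t)]⟩ * C,
    fun s hs s' hs' => ?_⟩
  have hoc : (I ∩ Metric.ball t (min ε δ)).OrdConnected :=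
    hI.inter (convex_ball t _).ordConnected
  have huIcc : uIcc s s' ⊆ I ∩ Metric.ball t (min ε δ) := hoc.uIcc_subset hs hs'
  have hlip : LipschitzOnWith C γ (uIcc s s') := hC.mono fun u hu =>
    ⟨(huIcc hu).1, Metric.ball_subset_ball (min_le_left _ _) (huIcc hu).2⟩
  refine hlip.dK_le (M := K (γ t) + 1) (by linarith [hK0 (γ t)]) fun u hu => ?_
  have hu' := huIcc hu
  exact le_of_lt (hsub ⟨Metric.ball_subset_ball (min_le_right _ _) hu'.2, hu'.1,
    Metric.ball_subset_ball (min_le_left _ _) hu'.2⟩)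

end MainTheorem

/-- Under hypotheses (H1)-(H3), every `d`-locally Lipschitz curve `γ : I → X` is
locally Lipschitz for `d_K`, and its metric derivative in `(X, d_K)` equals
`K (γ t) * |γ̇| t` for a.e. `t ∈ I`. -/
theorem dK_metricDeriv_of_locallyLipschitz
    {X : Type*} [MetricSpace X] [ProperSpace X] (hlen : IsLengthSpace X)
    (K : X → ℝ) (hKc : Continuous K) (hK0 : ∀ x, 0 ≤ K x)
    (hfin : {x : X | K x = 0}.Finite)
    (k : ℝ → ℝ) (hkc : ContinuousOn k (Set.Ici 0)) (hk0 : ∀ t ∈ Set.Ici (0 : ℝ), 0 ≤ k t)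
    (hkdiv : ∫⁻ t in Set.Ioi (0 : ℝ), ENNReal.ofReal (k t) = ⊤)
    (hlow : ∀ x : X, k (Metric.infDist x {x : X | K x = 0}) ≤ K x)
    (γ : ℝ → X) (I : Set ℝ) (hne : I.Nonempty) (hint : I.OrdConnected)
    (hγ : LocallyLipschitzOnSet γ I) :
    -- `γ` is locally Lipschitz from `I` to `(X, d_K)`:
    (∀ t ∈ I, ∃ ε > (0 : ℝ), ∃ C : NNReal,
        ∀ s ∈ I ∩ Metric.ball t ε, ∀ s' ∈ I ∩ Metric.ball t ε,
          dK K (γ s) (γ s') ≤ ENNReal.ofReal (C * |s - s'|)) ∧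
    -- a.e. the `d_K`-metric derivative of `γ` exists and equals `K (γ t) * |γ̇| t`:
    ∀ᵐ t ∂(volume.restrict I),
      Tendsto (fun s => (dK K (γ t) (γ s)).toReal / |s - t|) (𝓝[I \ {t}] t)
        (𝓝 (K (γ t) * metricDerivWithin γ I t)) := by
  refine ⟨fun t ht => hγ.exists_dK_le hKc hK0 hint ht, ?_⟩
  rw [ae_restrict_iff' hint.measurableSet]
  filter_upwards [hγ.ae_tendsto_dK_div hKc hK0,
    compl_mem_ae_iff.2 (hint.finite_diff_interior.measure_zero volume)] with t h1 h2 ht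
  exact h1 (by_contra fun h => h2 ⟨ht, h⟩)
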